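/- arXiv:1701.00298 — 2 statements merged into one kernel-verified Lean document; each statement's English description precedes it below -/
import Mathlib

section
/- Let α > 2, P_t > 0, σ_S² > 0, β_e > 0, ε ∈ (0,1), and suppose λ_e > λ_e^* := (α/(2π·Γ(2/α)))·log(1/ε)·(P_t/(σ_S²β_e))^{−2/α}. Set A := α·log(1/ε)/(2πλ_e·(P_t/(σ_S²β_e))^{2/α}). Then there exists a unique r_g^* > 0 satisfying Γ(2/α, (r_g^*)^α β_e σ_S²/P_t) = A, and moreover for every r ≥ 0, P_sec^GZ(r) ≥ ε if and only if r ≥ r_g^*; in particular r_g^* is the minimum guard zone radius ensuring the secrecy constraint. -/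
open Real MeasureTheory Set

/-- The upper incomplete gamma function `Γ(a, b) = ∫_b^∞ t^(a-1) e^(-t) dt`. -/
noncomputable def uGamma (a b : ℝ) : ℝ := ∫ t in Set.Ioi b, t ^ (a - 1) * Real.exp (-t)

lemma uG_int (a : ℝ) (ha : 0 < a) :
    IntegrableOn (fun t : ℝ => t ^ (a - 1) * Real.exp (-t)) (Set.Ioi 0) := by
  refine (Real.GammaIntegral_convergent ha).congr_fun ?_ measurableSet_Ioi
  intro t _
  exact mul_comm _ _

lemma uG_zero (a : ℝ) (ha : 0 < a) : uGamma a 0 = Real.Gamma a := by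
  rw [Real.Gamma_eq_integral ha, uGamma]
  congr 1
  ext t
  exact mul_comm _ _

lemma uG_ii (a : ℝ) (ha : 0 < a) (b c : ℝ) (hb : 0 ≤ b) (hbc : b ≤ c) :
    IntervalIntegrable (fun t : ℝ => t ^ (a - 1) * Real.exp (-t)) volume b c := by
  rw [intervalIntegrable_iff_integrableOn_Ioc_of_le hbc]
  exact (uG_int a ha).mono_set (fun t ht => lt_of_le_of_lt hb ht.1)

lemma uG_sub (a : ℝ) (ha : 0 < a) (b c : ℝ) (hb : 0 ≤ b) (hbc : b ≤ c) :
    uGamma a b - uGamma a c = ∫ t in b..c, t ^ (a - 1) * Real.exp (-t) := by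
  have h1 : IntegrableOn (fun t : ℝ => t ^ (a - 1) * Real.exp (-t)) (Set.Ioi b) :=
    (uG_int a ha).mono_set (Set.Ioi_subset_Ioi hb)
  have h2 : IntegrableOn (fun t : ℝ => t ^ (a - 1) * Real.exp (-t)) (Set.Ioi c) :=
    h1.mono_set (Set.Ioi_subset_Ioi hbc)
  have h3 : IntegrableOn (fun t : ℝ => t ^ (a - 1) * Real.exp (-t)) (Set.Ioc b c) :=
    h1.mono_set Set.Ioc_subset_Ioi_self
  rw [intervalIntegral.integral_of_le hbc, uGamma, uGamma, ← Set.Ioc_union_Ioi_eq_Ioi hbc,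
    setIntegral_union (Set.Ioc_disjoint_Ioi le_rfl) measurableSet_Ioi h3 h2]
  ring

lemma uG_lt (a : ℝ) (ha : 0 < a) (b c : ℝ) (hb : 0 ≤ b) (hbc : b < c) :
    uGamma a c < uGamma a b := by
  have h := uG_sub a ha b c hb hbc.le
  have h2 : 0 < ∫ t in b..c, t ^ (a - 1) * Real.exp (-t) := by
    refine intervalIntegral.intervalIntegral_pos_of_pos_on (uG_ii a ha b c hb hbc.le) ?_ hbc
    intro t ht
    have : 0 < t := lt_of_le_of_lt hb ht.1
    positivity
  linarith

lemma uG_le_iff (a : ℝ) (ha : 0 < a) (b c : ℝ) (hb : 0 ≤ b) (hc : 0 ≤ c) :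
    uGamma a c ≤ uGamma a b ↔ b ≤ c := by
  constructor
  · intro h
    by_contra! h'
    exact absurd (uG_lt a ha c b hc h') (not_lt.mpr h)
  · intro h
    rcases h.eq_or_lt with rfl | h
    · exact le_rfl
    · exact (uG_lt a ha b c hb h).le

lemma uG_exists (a : ℝ) (ha : 0 < a) (A : ℝ) (hA : 0 < A) (hA' : A < Real.Gamma a) :
    ∃ c : ℝ, 0 < c ∧ uGamma a c = A := by
  have ht := intervalIntegral_tendsto_integral_Ioi 0 (uG_int a ha) Filter.tendsto_id
  have hG : ∫ t in Set.Ioi (0 : ℝ), t ^ (a - 1) * Real.exp (-t) = Real.Gamma a := uG_zero a ha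
  rw [hG] at ht
  have hev := (ht.eventually (lt_mem_nhds (show Real.Gamma a - A < Real.Gamma a by linarith))).and
    (Filter.eventually_gt_atTop 0)
  obtain ⟨b, hb, hb0⟩ := hev.exists
  have hcont : ContinuousOn (fun x => ∫ t in (0 : ℝ)..x, t ^ (a - 1) * Real.exp (-t))
      (Set.Icc 0 b) := by
    have := intervalIntegral.continuousOn_primitive_interval'
      (uG_ii a ha 0 b le_rfl hb0.le) Set.left_mem_uIcc
    rwa [Set.uIcc_of_le hb0.le] at this
  have hm : Real.Gamma a - A ∈ Set.Ioo (∫ t in (0 : ℝ)..0, t ^ (a - 1) * Real.exp (-t))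
      (∫ t in (0 : ℝ)..b, t ^ (a - 1) * Real.exp (-t)) := by
    refine ⟨?_, hb⟩
    rw [intervalIntegral.integral_same]
    linarith
  obtain ⟨c, hc, hceq⟩ := intermediate_value_Ioo hb0.le hcont hm
  refine ⟨c, hc.1, ?_⟩
  have := uG_sub a ha 0 c le_rfl hc.1.le
  rw [uG_zero a ha] at this
  simp only at hceq
  linarith

/-- Lemma 2 of the paper (nontrivial case): when the eavesdropper density exceeds the
threshold `λ_e^*`, there is a unique `r_g^* > 0` with `Γ(2/α, (r_g^*)^α β_e σ_S²/P_t) = A`,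
and the secrecy constraint `P_sec^GZ(r) ≥ ε` holds exactly for guard zone radii `r ≥ r_g^*`.
Here `σS` denotes the eavesdropper noise power `σ_S²` and `lamE` the eavesdropper density. -/
theorem optimal_guard_zone_radius (α Pt σS βe lamE ε : ℝ)
    (hα : 2 < α) (hPt : 0 < Pt) (hσS : 0 < σS) (hβe : 0 < βe)
    (hε : ε ∈ Set.Ioo (0 : ℝ) 1)
    (hlamE : lamE > α / (2 * π * Real.Gamma (2 / α)) * Real.log (1 / ε) *
      (Pt / (σS * βe)) ^ (-(2 / α)) ) :
    ∃ rg : ℝ, 0 < rg ∧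
      uGamma (2 / α) (rg ^ α * βe * σS / Pt) =
        α * Real.log (1 / ε) / (2 * π * lamE * (Pt / (σS * βe)) ^ (2 / α)) ∧
      (∀ r : ℝ, 0 < r →
        uGamma (2 / α) (r ^ α * βe * σS / Pt) =
          α * Real.log (1 / ε) / (2 * π * lamE * (Pt / (σS * βe)) ^ (2 / α)) → r = rg) ∧
      (∀ r : ℝ, 0 ≤ r →
        (Real.exp (-(2 * π * lamE / α) * (Pt / (σS * βe)) ^ (2 / α) *
            uGamma (2 / α) (r ^ α * βe * σS / Pt)) ≥ ε ↔ r ≥ rg)) := by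
  obtain ⟨hε0, hε1⟩ := hε
  have hα0 : 0 < α := by linarith
  have ha : 0 < 2 / α := by positivity
  have hL : 0 < Real.log (1 / ε) := Real.log_pos (by rw [lt_div_iff₀ hε0]; linarith)
  have hG : 0 < Real.Gamma (2 / α) := Real.Gamma_pos_of_pos ha
  have hLe : Real.log ε = -Real.log (1 / ε) := by
    rw [one_div, Real.log_inv, neg_neg]
  have hQ0 : 0 < Pt / (σS * βe) := by positivity
  rw [Real.rpow_neg hQ0.le] at hlamE
  have hQ : 0 < (Pt / (σS * βe)) ^ (2 / α) := Real.rpow_pos_of_pos hQ0 _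
  generalize (Pt / (σS * βe)) ^ (2 / α) = Q at *
  generalize Real.log (1 / ε) = L at *
  have hπ := Real.pi_pos
  have hlam : 0 < lamE := lt_trans (by positivity) hlamE
  have hA0 : 0 < α * L / (2 * π * lamE * Q) := by positivity
  have hA1 : α * L / (2 * π * lamE * Q) < Real.Gamma (2 / α) := by
    rw [div_lt_iff₀ (by positivity)]
    have h := mul_lt_mul_of_pos_right hlamE
      (show 0 < 2 * π * Real.Gamma (2 / α) * Q by positivity)
    have e : α / (2 * π * Real.Gamma (2 / α)) * L * Q⁻¹ * (2 * π * Real.Gamma (2 / α) * Q)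
        = α * L := by
      field_simp
    rw [e] at h
    linarith
  have hK : (2 * π * lamE / α) * Q * (α * L / (2 * π * lamE * Q)) = L := by
    field_simp
  generalize α * L / (2 * π * lamE * Q) = A at *
  have hKpos : 0 < (2 * π * lamE / α) * Q := by positivity
  obtain ⟨c, hc0, hc⟩ := uG_exists (2 / α) ha A hA0 hA1
  have hd : 0 < c * Pt / (βe * σS) := by positivity
  have hrg : 0 < (c * Pt / (βe * σS)) ^ α⁻¹ := Real.rpow_pos_of_pos hd _
  have hx : ((c * Pt / (βe * σS)) ^ α⁻¹) ^ α * βe * σS / Pt = c := by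
    rw [Real.rpow_inv_rpow hd.le hα0.ne']
    field_simp
  generalize (c * Pt / (βe * σS)) ^ α⁻¹ = rg at *
  have hnn : ∀ r : ℝ, 0 ≤ r → 0 ≤ r ^ α * βe * σS / Pt := fun r hr => by positivity
  have hmono : ∀ r s : ℝ, 0 ≤ r → 0 ≤ s →
      (r ^ α * βe * σS / Pt ≤ s ^ α * βe * σS / Pt ↔ r ≤ s) := by
    intro r s hr hs
    rw [div_le_div_iff_of_pos_right hPt, mul_le_mul_iff_left₀ hσS, mul_le_mul_iff_left₀ hβe,
      Real.rpow_le_rpow_iff hr hs hα0]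
  have hu : ∀ r s : ℝ, 0 ≤ r → 0 ≤ s →
      (uGamma (2 / α) (s ^ α * βe * σS / Pt) ≤ uGamma (2 / α) (r ^ α * βe * σS / Pt) ↔ r ≤ s) :=
    fun r s hr hs => (uG_le_iff _ ha _ _ (hnn r hr) (hnn s hs)).trans (hmono r s hr hs)
  have hA : uGamma (2 / α) (rg ^ α * βe * σS / Pt) = A := by rw [hx, hc]
  refine ⟨rg, hrg, hA, ?_, ?_⟩
  · intro r hr h
    exact le_antisymm ((hu r rg hr.le hrg.le).1 (by rw [hA, h]))
      ((hu rg r hrg.le hr.le).1 (by rw [hA, h]))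
  · intro r hr
    rw [ge_iff_le, ge_iff_le, ← hu rg r hrg.le hr, hA, ← Real.log_le_iff_le_exp hε0, hLe, ← hK,
      ← mul_le_mul_iff_right₀ (b := uGamma (2 / α) (r ^ α * βe * σS / Pt)) (c := A) hKpos]
    constructor <;> intro h <;> linarith
end

section
/- Let α > 2, P_t > 0, σ_S² > 0, σ_P² > 0, β_e > 0, β_t > 0, d > 0, ε ∈ (0,1), and λ_e > λ_e^* := (α/(2π·Γ(2/α)))·log(1/ε)·(P_t/(σ_S²β_e))^{−2/α}. Set A := α·log(1/ε)/(2πλ_e·(P_t/(σ_S²β_e))^{2/α}), let γ^* = G := (β_e/(1+β_e))·(1 + (σ_S²/P_t)·(α·log(1/ε)/(2πλ_e·Γ(2/α)))^{α/2}) (so 0 < G < 1), let r_g^* > 0 be the unique solution of Γ(2/α, (r_g^*)^α β_e σ_S²/P_t) = A, and define H := (β_e σ_S²/P_t)·[ (β_t·d^α·σ_P²/(P_t·λ_e·π))·(1/G − 1) ]^{α/2} and F := A − Γ(2/α, H). Then the guard zone coverage probability exceeds the artificial noise coverage probability, i.e., exp(−λ_e·π·(r_g^*)² − β_t·σ_P²·d^α/P_t)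 > exp(−β_t·σ_P²·d^α/(G·P_t)), if and only if F > 0. -/
open Real MeasureTheory Set

theorem uGamma_strictAntiOn {a : ℝ} (ha : 0 < a) : StrictAntiOn (uGamma a) (Set.Ici 0) := by
  intro x hx y hy hxy
  have hx0 : (0 : ℝ) ≤ x := hx
  have hint : IntegrableOn (fun t : ℝ => t ^ (a - 1) * Real.exp (-t)) (Set.Ioi 0) := by
    have := Real.GammaIntegral_convergent ha
    refine this.congr_fun (fun t _ => mul_comm _ _) measurableSet_Ioi
  have h1 : IntegrableOn (fun t : ℝ => t ^ (a - 1) * Real.exp (-t)) (Set.Ioc x y) :=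
    hint.mono_set (fun t ht => Set.mem_Ioi.2 (lt_of_le_of_lt hx0 ht.1))
  have h2 : IntegrableOn (fun t : ℝ => t ^ (a - 1) * Real.exp (-t)) (Set.Ioi y) :=
    hint.mono_set (fun t ht => Set.mem_Ioi.2 (lt_of_le_of_lt hy ht))
  have hpos : 0 < ∫ t in x..y, t ^ (a - 1) * Real.exp (-t) := by
    apply intervalIntegral.intervalIntegral_pos_of_pos_on
    · exact (intervalIntegrable_iff_integrableOn_Ioc_of_le hxy.le).2 h1
    · intro t ht
      have : 0 < t := lt_of_le_of_lt hx0 ht.1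
      positivity
    · exact hxy
  rw [intervalIntegral.integral_of_le hxy.le] at hpos
  unfold uGamma
  rw [← Set.Ioc_union_Ioi_eq_Ioi hxy.le,
    setIntegral_union (Set.Ioc_disjoint_Ioi le_rfl) measurableSet_Ioi h1 h2]
  linarith

/-- Theorem 1 of the paper (secrecy enhancement technique selection): for eavesdropper
densities above the threshold `λ_e^*`, the guard zone technique (with optimal radius
`r_g^*`) achieves a higher coverage probability than the artificial noise technique (with
optimal power split `γ^* = G`) if and only if the selection function `F = A − Γ(2/α, H)`
is positive. Here `σS` and `σP` denote the noise powers `σ_S²` and `σ_P²`, and `lamE` the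
eavesdropper density. -/
theorem technique_selection (α Pt σS σP βe βt d lamE ε A G H F rg : ℝ)
    (hα : 2 < α) (hPt : 0 < Pt) (hσS : 0 < σS) (hσP : 0 < σP) (hβe : 0 < βe)
    (hβt : 0 < βt) (hd : 0 < d) (hε : ε ∈ Set.Ioo (0 : ℝ) 1)
    (hlamE : lamE > α / (2 * π * Real.Gamma (2 / α)) * Real.log (1 / ε) *
      (Pt / (σS * βe)) ^ (-(2 / α)))
    (hA : A = α * Real.log (1 / ε) / (2 * π * lamE * (Pt / (σS * βe)) ^ (2 / α)))
    (hG : G = βe / (1 + βe) *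
      (1 + σS / Pt *
        (α * Real.log (1 / ε) / (2 * π * lamE * Real.Gamma (2 / α))) ^ (α / 2)))
    (hrg_pos : 0 < rg)
    (hrg : uGamma (2 / α) (rg ^ α * βe * σS / Pt) = A)
    (hH : H = βe * σS / Pt *
      (βt * d ^ α * σP / (Pt * lamE * π) * (1 / G - 1)) ^ (α / 2))
    (hF : F = A - uGamma (2 / α) H) :
    Real.exp (-(lamE * π * rg ^ 2) - βt * σP * d ^ α / Pt) >
      Real.exp (-(βt * σP * d ^ α / (G * Pt))) ↔ F > 0 := by
  obtain ⟨hε0, hε1⟩ := hε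
  have hL : 0 < Real.log (1 / ε) := Real.log_pos (by rw [lt_div_iff₀ hε0]; linarith)
  have hα0 : 0 < α := by linarith
  have h2α : 0 < 2 / α := by positivity
  have hΓ : 0 < Real.Gamma (2 / α) := Real.Gamma_pos_of_pos h2α
  have hπ := Real.pi_pos
  generalize hLdef : Real.log (1 / ε) = L at *
  generalize hΓdef : Real.Gamma (2 / α) = g at *
  have hX : 0 < Pt / (σS * βe) := by positivity
  have hlam : 0 < lamE := lt_trans (by positivity) hlamE
  have hlt : α * L / (2 * π * lamE * g) < (Pt / (σS * βe)) ^ (2 / α) := by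
    rw [Real.rpow_neg hX.le] at hlamE
    have hY : 0 < (Pt / (σS * βe)) ^ (2 / α) := by positivity
    generalize (Pt / (σS * βe)) ^ (2 / α) = Y at *
    rw [gt_iff_lt, ← div_eq_mul_inv, div_lt_iff₀ hY, div_mul_eq_mul_div,
      div_lt_iff₀ (by positivity)] at hlamE
    rw [div_lt_iff₀ (by positivity)]
    linarith
  have hlt2 : (α * L / (2 * π * lamE * g)) ^ (α / 2) < Pt / (σS * βe) := by
    have := Real.rpow_lt_rpow (by positivity) hlt (show 0 < α / 2 by positivity)
    rwa [← Real.rpow_mul hX.le, show 2 / α * (α / 2) = 1 by field_simp, Real.rpow_one] at this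
  have hZ : 0 < (α * L / (2 * π * lamE * g)) ^ (α / 2) := by positivity
  generalize (α * L / (2 * π * lamE * g)) ^ (α / 2) = Z at *
  have hG0 : 0 < G := by rw [hG]; positivity
  have hG1 : G < 1 := by
    rw [lt_div_iff₀ (by positivity)] at hlt2
    have h3 : βe * (σS / Pt * Z) < 1 := by
      rw [show βe * (σS / Pt * Z) = Z * (σS * βe) / Pt by ring, div_lt_one hPt]
      exact hlt2
    rw [hG, div_mul_eq_mul_div, div_lt_one (by positivity)]
    linarith
  have hGi : 0 < 1 / G - 1 := by
    rw [sub_pos, lt_div_iff₀ hG0]; linarith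
  have hD : 0 < d ^ α := by positivity
  generalize d ^ α = D at *
  have hK : 0 < βt * D * σP / (Pt * lamE * π) * (1 / G - 1) := by positivity
  generalize hKdef : βt * D * σP / (Pt * lamE * π) * (1 / G - 1) = K at *
  have hKe : lamE * π * K = βt * σP * D / (G * Pt) - βt * σP * D / Pt := by
    rw [← hKdef]; field_simp
  have hrα : rg ^ α = (rg ^ 2) ^ (α / 2) := by
    rw [← Real.rpow_natCast rg 2, ← Real.rpow_mul hrg_pos.le]
    congr 1
    push_cast
    ring
  have hc : 0 < βe * σS / Pt := by positivity
  rw [gt_iff_lt, Real.exp_lt_exp, hF, gt_iff_lt, sub_pos, ← hrg,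
    (uGamma_strictAntiOn h2α).lt_iff_gt
      (show H ∈ Set.Ici 0 by rw [hH, Set.mem_Ici]; positivity)
      (show _ ∈ Set.Ici 0 from (by positivity : (0 : ℝ) ≤ rg ^ α * βe * σS / Pt)),
    hH, hrα, show (rg ^ 2) ^ (α / 2) * βe * σS / Pt = βe * σS / Pt * (rg ^ 2) ^ (α / 2) by ring,
    mul_lt_mul_iff_right₀ hc, Real.rpow_lt_rpow_iff (by positivity) hK.le (by positivity),
    ← mul_lt_mul_iff_right₀ (b := rg ^ 2) (show 0 < lamE * π by positivity), hKe]
  constructor <;> intro h <;> linarith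
end
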